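/- Let 1 ≤ k ≤ d, θ ∈ ℝ^m, φ = [w_1, …, w_m] ∈ ℝ^{d×m}, and set A = Σ_{i=1}^m θ_i w_i w_i^T. Then the population squared loss of the quadratic network on the source distribution satisfies E_{(x,y)∼D_s^{(k)}}[(f_{θ,φ}(x) − y)^2] ≥ (2/3)·( Σ_{j=1}^k A_{jj} + (2/3)·Σ_{j=k+1}^d A_{jj} − 1 )^2. -/

import Mathlib

open MeasureTheory Finset

noncomputable section

/-- Uniform measure on `{-1, 0, 1} ⊆ ℝ`. -/
def unif3 : Measure ℝ :=
  (PMF.uniformOfFinset ({-1, 0, 1} : Finset ℝ) (by norm_num)).toMeasure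

/-- Uniform measure on `{-1, 1} ⊆ ℝ`. -/
def unif2 : Measure ℝ :=
  (PMF.uniformOfFinset ({-1, 1} : Finset ℝ) (by norm_num)).toMeasure

/-- Distribution of `x` conditioned on `y = 0` under the source distribution `D_s^(k)`. -/
def srcBranch0 (d k : ℕ) : Measure (Fin d → ℝ) :=
  Measure.pi (fun i => if (i : ℕ) < k then Measure.dirac (0 : ℝ) else unif3)

/-- Distribution of `x` conditioned on `y = 1` under the source distribution `D_s^(k)`. -/
def srcBranch1 (d k : ℕ) : Measure (Fin d → ℝ) :=
  Measure.pi (fun i => if (i : ℕ) < k then unif2 else unif3)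

/-- The source distribution `D_s^(k)` on `ℝ^d × ℝ`. -/
def sourceMeasure (d k : ℕ) : Measure ((Fin d → ℝ) × ℝ) :=
  (1/3 : ENNReal) • (srcBranch0 d k).map (fun x => (x, (0 : ℝ)))
    + (2/3 : ENNReal) • (srcBranch1 d k).map (fun x => (x, (1 : ℝ)))

/-- The target distribution `D_t = D_s^(1)`. -/
def targetMeasure (d : ℕ) : Measure ((Fin d → ℝ) × ℝ) := sourceMeasure d 1

/-- The two-layer quadratic network `f_{θ,φ}(x) = ∑ i, θ i (w_i ⬝ x)^2`,
where `w_i` is the `i`-th column of `φ`. -/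
def qnet {d m : ℕ} (θ : Fin m → ℝ) (φ : Matrix (Fin d) (Fin m) ℝ) (x : Fin d → ℝ) : ℝ :=
  ∑ i, θ i * (∑ j, φ j i * x j) ^ 2

/-- Population squared loss on the distribution `D`. -/
def popLoss {d m : ℕ} (D : Measure ((Fin d → ℝ) × ℝ)) (θ : Fin m → ℝ)
    (φ : Matrix (Fin d) (Fin m) ℝ) : ℝ :=
  ∫ p, (qnet θ φ p.1 - p.2) ^ 2 ∂D

/-- Empirical squared loss on the dataset `S`. -/
def empLoss {d m n : ℕ} (S : Fin n → (Fin d → ℝ) × ℝ) (θ : Fin m → ℝ)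
    (φ : Matrix (Fin d) (Fin m) ℝ) : ℝ :=
  (1 / (n : ℝ)) * ∑ i, (qnet θ φ (S i).1 - (S i).2) ^ 2

/-- Squared Frobenius norm of the feature extractor. -/
def frobSq {d m : ℕ} (φ : Matrix (Fin d) (Fin m) ℝ) : ℝ := ∑ j, ∑ i, (φ j i) ^ 2

/-- Squared Euclidean norm of a head. -/
def normSq {m : ℕ} (θ : Fin m → ℝ) : ℝ := ∑ i, (θ i) ^ 2

/-- The regularized joint training objective `L_joint^λ`. -/
def jointObj {d m n : ℕ} (k : ℕ) (α lam : ℝ) (S : Fin n → (Fin d → ℝ) × ℝ)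
    (θs θt : Fin m → ℝ) (φ : Matrix (Fin d) (Fin m) ℝ) : ℝ :=
  (1 - α) * popLoss (sourceMeasure d k) θs φ + α * empLoss S θt φ
    + lam * (normSq θs + normSq θt + frobSq φ)

end

lemma unif_ae_aux (s : Finset ℝ) (hs : s.Nonempty) (h : ∀ x ∈ s, |x| ≤ 1) :
    ∀ᵐ x ∂(PMF.uniformOfFinset s hs).toMeasure, |x| ≤ 1 := by
  rw [ae_iff, PMF.toMeasure_apply_eq_zero_iff _ (by
    apply MeasurableSet.compl
    exact (isClosed_le continuous_abs continuous_const).measurableSet)]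
  rw [PMF.support_uniformOfFinset, Set.disjoint_left]
  intro x hx hx'
  exact hx' (h x hx)

lemma cont_integrable_aux (μ : Measure ℝ) [IsProbabilityMeasure μ] (hμ : ∀ᵐ x ∂μ, |x| ≤ 1)
    (f : ℝ → ℝ) (hf : Continuous f) : Integrable f μ := by
  obtain ⟨C, hC⟩ := (isCompact_Icc (a := (-1 : ℝ)) (b := 1)).exists_bound_of_continuousOn
    hf.continuousOn
  refine Integrable.of_bound hf.aestronglyMeasurable C ?_
  filter_upwards [hμ] with x hx
  exact hC x (abs_le.mp hx)

lemma pi_integrable_aux {d : ℕ} (μ : Fin d → Measure ℝ) [∀ i, IsProbabilityMeasure (μ i)]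
    (hμ : ∀ i, ∀ᵐ x ∂(μ i), |x| ≤ 1)
    (f : (Fin d → ℝ) → ℝ) (hf : Continuous f) : Integrable f (Measure.pi μ) := by
  obtain ⟨C, hC⟩ := (isCompact_Icc (a := (fun _ => -1 : Fin d → ℝ))
    (b := fun _ => 1)).exists_bound_of_continuousOn hf.continuousOn
  refine Integrable.of_bound hf.aestronglyMeasurable C ?_
  have : ∀ᵐ x ∂(Measure.pi μ), ∀ i, |x i| ≤ 1 := by
    rw [ae_all_iff]
    intro i
    exact (Measure.quasiMeasurePreserving_eval μ i).ae (hμ i)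
  filter_upwards [this] with x hx
  exact hC x ⟨fun i => (abs_le.mp (hx i)).1, fun i => (abs_le.mp (hx i)).2⟩

lemma unif_integral_aux (s : Finset ℝ) (hs : s.Nonempty) (h : ∀ x ∈ s, |x| ≤ 1)
    (f : ℝ → ℝ) (hf : Continuous f) :
    ∫ x, f x ∂(PMF.uniformOfFinset s hs).toMeasure = (∑ x ∈ s, f x) / s.card := by
  rw [PMF.integral_eq_tsum _ _ (cont_integrable_aux _ (unif_ae_aux s hs h) f hf)]
  rw [tsum_eq_sum (s := s)]
  · rw [Finset.sum_div]
    refine Finset.sum_congr rfl fun x hx => ?_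
    simp [PMF.uniformOfFinset_apply, hx]
    field_simp
  · intro x hx
    simp [PMF.uniformOfFinset_apply, hx]

instance : IsProbabilityMeasure unif2 := by unfold unif2; infer_instance
instance : IsProbabilityMeasure unif3 := by unfold unif3; infer_instance

lemma unif2_ae : ∀ᵐ x ∂unif2, |x| ≤ 1 := unif_ae_aux _ _ (by simp)
lemma unif3_ae : ∀ᵐ x ∂unif3, |x| ≤ 1 := unif_ae_aux _ _ (by simp)
lemma unif2_mean : ∫ x, x ∂unif2 = 0 := by
  unfold unif2
  rw [unif_integral_aux _ _ (by simp) _ (by fun_prop)]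
  rw [Finset.sum_pair (by norm_num)]; norm_num
lemma unif2_sq : ∫ x, x ^ 2 ∂unif2 = 1 := by
  unfold unif2
  rw [unif_integral_aux _ _ (by simp) _ (by fun_prop)]
  rw [Finset.sum_pair (by norm_num), Finset.card_pair (by norm_num)]; norm_num
lemma unif3_mean : ∫ x, x ∂unif3 = 0 := by
  unfold unif3
  rw [unif_integral_aux _ _ (by simp) _ (by fun_prop)]
  rw [Finset.sum_insert (by norm_num), Finset.sum_pair (by norm_num)]; norm_num
lemma unif3_sq : ∫ x, x ^ 2 ∂unif3 = 2 / 3 := by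
  unfold unif3
  rw [unif_integral_aux _ _ (by simp) _ (by fun_prop)]
  rw [Finset.sum_insert (by norm_num), Finset.sum_pair (by norm_num),
    Finset.card_insert_of_notMem (by norm_num), Finset.card_pair (by norm_num)]; norm_num

lemma pi_quad_aux {d : ℕ} (μ : Fin d → Measure ℝ) [∀ i, IsProbabilityMeasure (μ i)]
    (hμ : ∀ i, ∀ᵐ x ∂(μ i), |x| ≤ 1) (c : Fin d → ℝ)
    (h1 : ∀ i, ∫ x, x ∂(μ i) = 0) (h2 : ∀ i, ∫ x, x ^ 2 ∂(μ i) = c i) (v : Fin d → ℝ) :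
    ∫ x, (∑ j, v j * x j) ^ 2 ∂(Measure.pi μ) = ∑ j, v j ^ 2 * c j := by
  have key : ∀ (i : Fin d) (f : ℝ → ℝ), Continuous f →
      ∫ x, f (x i) ∂(Measure.pi μ) = ∫ x, f x ∂(μ i) := by
    intro i f hf
    have := integral_map (μ := Measure.pi μ) (φ := Function.eval i) (f := f)
      (measurable_pi_apply i).aemeasurable
      (by rw [(measurePreserving_eval μ i).map_eq]; exact hf.aestronglyMeasurable)
    rw [(measurePreserving_eval μ i).map_eq] at this
    exact this.symm
  have hcov : ∀ i j, ∫ x, x i * x j ∂(Measure.pi μ) = if i = j then c i else 0 := by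
    intro i j
    split_ifs with hij
    · subst hij
      rw [← h2 i, ← key i (fun x => x ^ 2) (by fun_prop)]
      simp [sq]
    · have hind := (ProbabilityTheory.iIndepFun_pi (μ := μ) (X := fun _ x => x)
        (fun i => aemeasurable_id)).indepFun hij
      have := hind.integral_fun_mul_eq_mul_integral
        (Continuous.aestronglyMeasurable (by fun_prop))
        (Continuous.aestronglyMeasurable (by fun_prop))
      rw [this, key i (fun x => x) (by fun_prop), h1, zero_mul]
  have e : ∀ x : Fin d → ℝ, (∑ j, v j * x j) ^ 2 = ∑ i, ∑ j, (v i * v j) * (x i * x j) := by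
    intro x
    rw [sq, Finset.sum_mul_sum]
    refine Finset.sum_congr rfl fun i _ => Finset.sum_congr rfl fun j _ => by ring
  simp_rw [e]
  rw [integral_finsetSum _ (fun i _ => pi_integrable_aux μ hμ _ (by fun_prop))]
  refine Finset.sum_congr rfl fun i _ => ?_
  rw [integral_finsetSum _ (fun j _ => pi_integrable_aux μ hμ _ (by fun_prop))]
  simp_rw [integral_const_mul, hcov]
  simp [sq]

lemma qnet_cont {d m : ℕ} (θ : Fin m → ℝ) (φ : Matrix (Fin d) (Fin m) ℝ) :
    Continuous (qnet θ φ) := by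
  unfold qnet; fun_prop

/-- The source population loss lower bound: with `A = ∑ i, θ_i w_i w_iᵀ` (where `w_i` is the
`i`-th column of `φ`),
`L_{D_s^{(k)}}(θ, φ) ≥ (2/3) (∑_{j ≤ k} A_{jj} + (2/3) ∑_{j > k} A_{jj} - 1)²`.
(Coordinates are 0-based: `(j : ℕ) < k` corresponds to the paper's `j ∈ {1, …, k}`.) -/
theorem source_loss_lower_bound (d m k : ℕ) (hk1 : 1 ≤ k) (hkd : k ≤ d)
    (θ : Fin m → ℝ) (φ : Matrix (Fin d) (Fin m) ℝ)
    (A : Matrix (Fin d) (Fin d) ℝ)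
    (hA : A = ∑ i, θ i • Matrix.vecMulVec (fun j => φ j i) (fun j => φ j i)) :
    popLoss (sourceMeasure d k) θ φ ≥
      (2 / 3) * ((∑ j ∈ Finset.univ.filter (fun j : Fin d => (j : ℕ) < k), A j j)
          + (2 / 3) * (∑ j ∈ Finset.univ.filter (fun j : Fin d => ¬ (j : ℕ) < k), A j j)
          - 1) ^ 2 := by
  have hp0 : ∀ i : Fin d, IsProbabilityMeasure
      (if (i : ℕ) < k then Measure.dirac (0 : ℝ) else unif3) := by
    intro i; split_ifs <;> infer_instance
  have hp1 : ∀ i : Fin d, IsProbabilityMeasure (if (i : ℕ) < k then unif2 else unif3) := by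
    intro i; split_ifs <;> infer_instance
  have hb0 : ∀ i : Fin d, ∀ᵐ x ∂(if (i : ℕ) < k then Measure.dirac (0 : ℝ) else unif3),
      |x| ≤ 1 := by
    intro i; split_ifs
    · rw [ae_dirac_eq]; simp
    · exact unif3_ae
  have hb1 : ∀ i : Fin d, ∀ᵐ x ∂(if (i : ℕ) < k then unif2 else unif3), |x| ≤ 1 := by
    intro i; split_ifs
    · exact unif2_ae
    · exact unif3_ae
  have hq := qnet_cont θ φ
  have hc : Continuous (fun p : (Fin d → ℝ) × ℝ => (qnet θ φ p.1 - p.2) ^ 2) := by fun_prop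
  have hI0 : ∀ f : (Fin d → ℝ) → ℝ, Continuous f → Integrable f (srcBranch0 d k) :=
    fun f hf => pi_integrable_aux _ hb0 f hf
  have hI1 : ∀ f : (Fin d → ℝ) → ℝ, Continuous f → Integrable f (srcBranch1 d k) :=
    fun f hf => pi_integrable_aux _ hb1 f hf
  have : IsProbabilityMeasure (srcBranch1 d k) := by unfold srcBranch1; infer_instance
  have hJ0 : Integrable (fun p : (Fin d → ℝ) × ℝ => (qnet θ φ p.1 - p.2) ^ 2)
      ((srcBranch0 d k).map (fun x => (x, (0 : ℝ)))) :=
    (integrable_map_measure hc.aestronglyMeasurable (by fun_prop)).2 (hI0 _ (by fun_prop))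
  have hJ1 : Integrable (fun p : (Fin d → ℝ) × ℝ => (qnet θ φ p.1 - p.2) ^ 2)
      ((srcBranch1 d k).map (fun x => (x, (1 : ℝ)))) :=
    (integrable_map_measure hc.aestronglyMeasurable (by fun_prop)).2 (hI1 _ (by fun_prop))
  have hloss : popLoss (sourceMeasure d k) θ φ =
      (1 / 3) * ∫ x, (qnet θ φ x - 0) ^ 2 ∂(srcBranch0 d k)
      + (2 / 3) * ∫ x, (qnet θ φ x - 1) ^ 2 ∂(srcBranch1 d k) := by
    unfold popLoss sourceMeasure
    rw [integral_add_measure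
      (hJ0.smul_measure (ENNReal.div_ne_top (by simp) (by simp)))
      (hJ1.smul_measure (ENNReal.div_ne_top (by simp) (by simp))),
      integral_smul_measure, integral_smul_measure,
      integral_map (by fun_prop) hc.aestronglyMeasurable,
      integral_map (by fun_prop) hc.aestronglyMeasurable]
    simp
  have hmean : ∫ x, qnet θ φ x ∂(srcBranch1 d k) =
      (∑ j ∈ Finset.univ.filter (fun j : Fin d => (j : ℕ) < k), A j j)
          + (2 / 3) * (∑ j ∈ Finset.univ.filter (fun j : Fin d => ¬ (j : ℕ) < k), A j j) := by
    have hquad : ∀ v : Fin d → ℝ, ∫ x, (∑ j, v j * x j) ^ 2 ∂(srcBranch1 d k) =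
        ∑ j : Fin d, v j ^ 2 * (if (j : ℕ) < k then 1 else 2 / 3) := by
      intro v
      refine pi_quad_aux _ hb1 _ ?_ ?_ v
      · intro i; split_ifs
        · exact unif2_mean
        · exact unif3_mean
      · intro i; split_ifs
        · exact unif2_sq
        · exact unif3_sq
    have hAj : ∀ j, A j j = ∑ i, θ i * φ j i ^ 2 := by
      intro j
      rw [hA, Matrix.sum_apply]
      simp [Matrix.vecMulVec_apply, sq]
    unfold qnet
    rw [integral_finsetSum _ (fun i _ => hI1 _ (by fun_prop))]
    simp_rw [integral_const_mul, hquad, Finset.mul_sum]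
    rw [Finset.sum_comm, Finset.sum_filter, Finset.sum_filter, ← Finset.sum_add_distrib]
    refine Finset.sum_congr rfl fun j _ => ?_
    rw [hAj]
    by_cases hj : (j : ℕ) < k
    · simp [hj]
    · simp only [hj, if_false, not_false_eq_true, if_true, Finset.mul_sum, zero_add]
      exact Finset.sum_congr rfl fun i _ => by ring
  rw [hloss, ← hmean]
  have h0 : 0 ≤ ∫ x, (qnet θ φ x - 0) ^ 2 ∂(srcBranch0 d k) :=
    integral_nonneg fun x => sq_nonneg _
  set M := ∫ x, qnet θ φ x ∂(srcBranch1 d k) with hM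
  have h1 : (M - 1) ^ 2 ≤ ∫ x, (qnet θ φ x - 1) ^ 2 ∂(srcBranch1 d k) := by
    have hlin : ∫ x, (2 * (M - 1) * (qnet θ φ x - 1) - (M - 1) ^ 2) ∂(srcBranch1 d k)
        = (M - 1) ^ 2 := by
      rw [integral_sub (hI1 _ (by fun_prop)) (hI1 _ (by fun_prop)), integral_const_mul,
        integral_sub (hI1 _ (by fun_prop)) (hI1 _ (by fun_prop)), ← hM]
      simp
      ring
    rw [← hlin]
    refine integral_mono (hI1 _ (by fun_prop)) (hI1 _ (by fun_prop)) fun x => ?_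
    nlinarith [sq_nonneg (qnet θ φ x - 1 - (M - 1))]
  nlinarith
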